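/- arXiv:2004.02579 — 3 statements merged into one kernel-verified Lean document; each statement's English description precedes it below -/
import Mathlib

section
/- Let T > 0, let g : ℝ → ℝ be Lebesgue integrable with g(τ) = 0 for τ < 0, let u : ℤ → ℝ be finitely supported, and define the zero-order-hold signal u_c(t) = Σ_{n∈ℤ} u_n·𝟙_{[nT,(n+1)T)}(t). Then for every l ∈ ℤ: ∫_ℝ g(τ)·u_c(lT − τ) dτ = Σ_{n∈ℤ} g_{zoh}(l − n)·u_n, where g_{zoh}(m) = ∫_{(m−1)T}^{mT} g(τ) dτ. -/
open MeasureTheory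

/-- Step-invariant transform of a degree-one Volterra kernel: for a
causal integrable impulse response `g` and the zero-order-hold interpolation
`u_c` of a finitely supported sequence `u`, the sampled convolution satisfies
`∫ g(τ)·u_c(lT − τ) dτ = Σ_n g_zoh(l − n)·u_n` with
`g_zoh(m) = ∫_{(m−1)T}^{mT} g(τ) dτ`. -/
theorem stmt_8 (T : ℝ) (hT : 0 < T)
    (g : ℝ → ℝ) (hg : Integrable g (volume : Measure ℝ))
    (hgcausal : ∀ τ : ℝ, τ < 0 → g τ = 0)
    (u : ℤ → ℝ) (hu : (Function.support u).Finite)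
    (uc : ℝ → ℝ)
    (huc : ∀ s : ℝ, uc s =
      ∑ᶠ n : ℤ, u n * Set.indicator (Set.Ico ((n : ℝ) * T) (((n : ℝ) + 1) * T)) 1 s) :
    ∀ l : ℤ,
      ∫ τ : ℝ, g τ * uc ((l : ℝ) * T - τ) =
        ∑ᶠ n : ℤ, (∫ τ in (((l - n : ℤ) : ℝ) - 1) * T..((l - n : ℤ) : ℝ) * T, g τ) * u n := by
  intro l
  have hterm : ∀ (n : ℤ) (τ : ℝ),
      g τ * (u n * Set.indicator (Set.Ico ((n : ℝ) * T) (((n : ℝ) + 1) * T)) 1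
        ((l : ℝ) * T - τ)) =
      Set.indicator (Set.Ioc ((((l - n : ℤ) : ℝ) - 1) * T) (((l - n : ℤ) : ℝ) * T)) g τ
        * u n := by
    intro n τ
    have hmem : (l : ℝ) * T - τ ∈ Set.Ico ((n : ℝ) * T) (((n : ℝ) + 1) * T) ↔
        τ ∈ Set.Ioc ((((l - n : ℤ) : ℝ) - 1) * T) (((l - n : ℤ) : ℝ) * T) := by
      push_cast
      constructor <;> rintro ⟨h₁, h₂⟩ <;> constructor <;> linarith
    by_cases h : τ ∈ Set.Ioc ((((l - n : ℤ) : ℝ) - 1) * T) (((l - n : ℤ) : ℝ) * T)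
    · rw [Set.indicator_of_mem h, Set.indicator_of_mem (hmem.2 h)]
      simp
    · rw [Set.indicator_of_notMem h, Set.indicator_of_notMem (mt hmem.1 h)]
      simp
  have hsum : ∀ τ : ℝ, g τ * uc ((l : ℝ) * T - τ) = ∑ n ∈ hu.toFinset,
      Set.indicator (Set.Ioc ((((l - n : ℤ) : ℝ) - 1) * T) (((l - n : ℤ) : ℝ) * T)) g τ
        * u n := by
    intro τ
    rw [huc, finsum_eq_sum_of_support_subset (s := hu.toFinset), Finset.mul_sum]
    · exact Finset.sum_congr rfl fun n _ => hterm n τ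
    · rw [hu.coe_toFinset]
      exact fun n hn => left_ne_zero_of_mul hn
  rw [finsum_eq_sum_of_support_subset (s := hu.toFinset)]
  · simp_rw [hsum]
    rw [integral_finsetSum _ fun n _ => (hg.indicator measurableSet_Ioc).mul_const (u n)]
    refine Finset.sum_congr rfl fun n _ => ?_
    rw [integral_mul_const, integral_indicator measurableSet_Ioc,
      intervalIntegral.integral_of_le (by nlinarith)]
  · rw [hu.coe_toFinset]
    exact fun n hn => right_ne_zero_of_mul hn
end

section
/- Let T > 0, let g₂ : ℝ² → ℝ be Lebesgue integrable with g₂(τ₁, τ₂) = 0 whenever τ₁ < 0 or τ₂ < 0, let u : ℤ → ℝ be finitely supported, and define the zero-order-hold signal u_c(t) = Σ_{n∈ℤ} u_n·𝟙_{[nT,(n+1)T)}(t). Then for every l ∈ ℤ: ∫_ℝ ∫_ℝ g₂(τ₁, τ₂)·u_c(lT − τ₁)·u_c(lT − τ₂) dτ₁ dτ₂ = Σ_{n₁,n₂∈ℤ} g_{2,zoh}(l − n₁, l − n₂)·u_{n₁}·u_{n₂}, where g_{2,zoh}(m₁, m₂) = ∫_{(m₂−1)T}^{m₂T} ∫_{(m₁−1)T}^{m₁T}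 g₂(τ₁, τ₂) dτ₁ dτ₂. -/
open MeasureTheory

/-- For a finite combination `w` of indicator functions, integrating an integrable `f` on the plane
against `w ⊗ w` gives the corresponding double sum of integrals over boxes. -/
theorem integral_mul_sum_indicator {ι : Type*} (s : Finset ι) (c : ι → ℝ) (A : ι → Set ℝ)
    (hA : ∀ i, MeasurableSet (A i)) (f : ℝ → ℝ → ℝ)
    (hf : Integrable (fun p : ℝ × ℝ => f p.1 p.2) (volume : Measure (ℝ × ℝ))) (w : ℝ → ℝ)
    (hw : ∀ x, w x = ∑ i ∈ s, c i * (A i).indicator 1 x) :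
    ∫ y : ℝ, ∫ x : ℝ, f x y * w x * w y =
      ∑ i ∈ s, ∑ j ∈ s, (∫ y in A j, ∫ x in A i, f x y) * c i * c j := by
  have hsec : ∀ᵐ y : ℝ, Integrable (fun x => f x y) volume := by
    rw [Measure.volume_eq_prod] at hf
    exact hf.prod_left_ae
  have hint : ∀ i, Integrable (fun y => ∫ x in A i, f x y) volume := by
    intro i
    have h : Integrable (fun p : ℝ × ℝ => f p.1 p.2)
        ((volume.restrict (A i)).prod volume) := by
      rw [Measure.restrict_prod_eq_prod_univ]
      exact hf.restrict
    exact h.integral_prod_right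
  have hinner : ∀ᵐ y : ℝ, ∫ x : ℝ, f x y * w x * w y =
      ∑ i ∈ s, ∑ j ∈ s, (A j).indicator (fun y => ∫ x in A i, f x y) y * (c i * c j) := by
    filter_upwards [hsec] with y hy
    have hx : ∀ x, f x y * w x = ∑ i ∈ s, (A i).indicator (fun x => f x y) x * c i := by
      intro x
      rw [hw, Finset.mul_sum]
      refine Finset.sum_congr rfl fun i _ => ?_
      by_cases h : x ∈ A i <;> simp [h]
    rw [integral_mul_const]
    simp_rw [hx]
    rw [integral_finsetSum _ fun i _ => (hy.indicator (hA i)).mul_const _, hw y,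
      Finset.sum_mul_sum]
    refine Finset.sum_congr rfl fun i _ => Finset.sum_congr rfl fun j _ => ?_
    rw [integral_mul_const, integral_indicator (hA i)]
    by_cases h : y ∈ A j <;> simp [h, mul_assoc]
  have hterm : ∀ i j, Integrable
      (fun y => (A j).indicator (fun y => ∫ x in A i, f x y) y * (c i * c j)) volume :=
    fun i j => ((hint i).indicator (hA j)).mul_const _
  rw [integral_congr_ae hinner,
    integral_finsetSum _ fun i _ => integrable_finsetSum _ fun j _ => hterm i j]
  refine Finset.sum_congr rfl fun i _ => ?_
  rw [integral_finsetSum _ fun j _ => hterm i j]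
  refine Finset.sum_congr rfl fun j _ => ?_
  rw [integral_mul_const, integral_indicator (hA j), mul_assoc]

/-- Step-invariant transform of a second-degree Volterra kernel:
the samples of the continuous-time response to a zero-order-hold input are
exactly given by a discrete-time second-degree Volterra kernel
`g_{2,zoh}(m₁,m₂) = ∫_{(m₂−1)T}^{m₂T}∫_{(m₁−1)T}^{m₁T} g₂(τ₁,τ₂) dτ₁ dτ₂`. -/
theorem stmt_10 (T : ℝ) (hT : 0 < T)
    (g₂ : ℝ → ℝ → ℝ)
    (hg₂ : Integrable (fun p : ℝ × ℝ => g₂ p.1 p.2) (volume : Measure (ℝ × ℝ)))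
    (hcausal : ∀ τ₁ τ₂ : ℝ, τ₁ < 0 ∨ τ₂ < 0 → g₂ τ₁ τ₂ = 0)
    (u : ℤ → ℝ) (hu : (Function.support u).Finite)
    (uc : ℝ → ℝ)
    (huc : ∀ s : ℝ, uc s =
      ∑ᶠ n : ℤ, u n * Set.indicator (Set.Ico ((n : ℝ) * T) (((n : ℝ) + 1) * T)) 1 s) :
    ∀ l : ℤ,
      ∫ τ₂ : ℝ, ∫ τ₁ : ℝ, g₂ τ₁ τ₂ * uc ((l : ℝ) * T - τ₁) * uc ((l : ℝ) * T - τ₂) =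
        ∑ᶠ n₁ : ℤ, ∑ᶠ n₂ : ℤ,
          (∫ τ₂ in (((l - n₂ : ℤ) : ℝ) - 1) * T..((l - n₂ : ℤ) : ℝ) * T,
            ∫ τ₁ in (((l - n₁ : ℤ) : ℝ) - 1) * T..((l - n₁ : ℤ) : ℝ) * T, g₂ τ₁ τ₂) *
            u n₁ * u n₂ := by
  intro l
  have hsub : ∀ n : ℤ, n ∉ hu.toFinset → u n = 0 := by simp
  have hle : ∀ n : ℤ, (((l - n : ℤ) : ℝ) - 1) * T ≤ ((l - n : ℤ) : ℝ) * T := fun n => by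
    nlinarith
  have hw : ∀ x, uc ((l : ℝ) * T - x) = ∑ n ∈ hu.toFinset, u n *
      (Set.Ioc ((((l - n : ℤ) : ℝ) - 1) * T) (((l - n : ℤ) : ℝ) * T)).indicator 1 x := by
    intro x
    rw [huc, finsum_eq_sum_of_support_subset (s := hu.toFinset)]
    · refine Finset.sum_congr rfl fun n _ => ?_
      congr 1
      refine Set.indicator_eq_indicator ?_ rfl
      simp only [Set.mem_Ico, Set.mem_Ioc]
      push_cast
      constructor <;> rintro ⟨h₁, h₂⟩ <;> constructor <;> linarith
    · intro n hn
      by_contra h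
      exact hn (by simp [hsub n h])
  rw [integral_mul_sum_indicator hu.toFinset u _ (fun _ => measurableSet_Ioc) g₂ hg₂
    (fun x => uc ((l : ℝ) * T - x)) hw]
  simp_rw [intervalIntegral.integral_of_le (hle _)]
  rw [finsum_eq_sum_of_support_subset (s := hu.toFinset)]
  · refine Finset.sum_congr rfl fun n _ => ?_
    rw [finsum_eq_sum_of_support_subset (s := hu.toFinset)]
    intro m hm
    by_contra h
    exact hm (by simp [hsub m h])
  · intro n hn
    by_contra h
    exact hn (by simp [hsub n h])
end

section
/- Let α ≥ 1 be a natural number, T > 0, let g : ℝ^α → ℝ be Lebesgue integrable with g(τ) = 0 whenever some coordinate τ_i < 0, let u : ℤ → ℝ be finitely supported, and define the zero-order-hold signal u_c(t) = Σ_{n∈ℤ} u_n·𝟙_{[nT,(n+1)T)}(t). Then for every l ∈ ℤ: ∫_{ℝ^α} g(τ)·∏_{i=1}^{α} u_c(lT − τ_i) dτ = Σ_{n : Fin α → ℤ} g_{zoh}(l − n_1, …, l − n_α)·∏_{i=1}^{α} u_{n_i}, where g_{zoh}(m_1, …, m_α) is the integral of g over the box ∏_{i=1}^{α} [(m_i −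 1)T, m_i T]. -/
open MeasureTheory

/-- A product of coordinate indicators is the indicator of the box. -/
theorem prod_indicator_one_eq_indicator_pi {ι : Type*} [Fintype ι] {X : Type*}
    (s : ι → Set X) (x : ι → X) :
    ∏ i, (s i).indicator (1 : X → ℝ) (x i) =
      (Set.univ.pi s).indicator (1 : (ι → X) → ℝ) x := by
  classical
  by_cases h : x ∈ Set.univ.pi s
  · rw [Set.indicator_of_mem h]
    exact Finset.prod_eq_one fun i _ => Set.indicator_of_mem (h i (Set.mem_univ i)) _
  · rw [Set.indicator_of_notMem h]
    simp only [Set.mem_univ_pi, not_forall] at h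
    obtain ⟨i, hi⟩ := h
    exact Finset.prod_eq_zero (Finset.mem_univ i) (Set.indicator_of_notMem hi _)

/-- A zero-order-hold signal, reflected about the sampling instant `l * T`, as a finite
combination of indicators of left-open intervals. -/
theorem zeroOrderHold_sub_eq_sum {T : ℝ} {u : ℤ → ℝ} (hu : (Function.support u).Finite)
    {uc : ℝ → ℝ}
    (huc : ∀ s : ℝ, uc s =
      ∑ᶠ n : ℤ, u n * Set.indicator (Set.Ico ((n : ℝ) * T) (((n : ℝ) + 1) * T)) 1 s)
    (l : ℤ) (t : ℝ) :
    uc ((l : ℝ) * T - t) = ∑ n ∈ hu.toFinset, u n *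
      (Set.Ioc ((((l - n : ℤ) : ℝ) - 1) * T) (((l - n : ℤ) : ℝ) * T)).indicator 1 t := by
  rw [huc, finsum_eq_sum_of_support_subset (s := hu.toFinset)]
  · refine Finset.sum_congr rfl fun n _ => ?_
    congr 1
    simp only [Set.indicator_apply, Pi.one_apply]
    refine if_congr ?_ rfl rfl
    simp only [Set.mem_Ico, Set.mem_Ioc]
    push_cast
    constructor <;> rintro ⟨h₁, h₂⟩ <;> constructor <;> linarith
  · intro n hn
    simpa using left_ne_zero_of_mul (Function.mem_support.mp hn)

/-- General step-invariant transform: at the sampling instants, a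
continuous-time Volterra kernel of degree `α` excited by a zero-order-hold
input is described exactly by the discrete-time Volterra kernel whose values
are the integrals of `g` over the boxes `∏_i [(m_i−1)T, m_i T]`. -/
theorem stmt_11 (α : ℕ) (hα : 1 ≤ α) (T : ℝ) (hT : 0 < T)
    (g : (Fin α → ℝ) → ℝ)
    (hg : Integrable g (volume : Measure (Fin α → ℝ)))
    (hcausal : ∀ τ : Fin α → ℝ, (∃ i, τ i < 0) → g τ = 0)
    (u : ℤ → ℝ) (hu : (Function.support u).Finite)
    (uc : ℝ → ℝ)
    (huc : ∀ s : ℝ, uc s =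
      ∑ᶠ n : ℤ, u n * Set.indicator (Set.Ico ((n : ℝ) * T) (((n : ℝ) + 1) * T)) 1 s) :
    ∀ l : ℤ,
      ∫ τ : Fin α → ℝ, g τ * ∏ i, uc ((l : ℝ) * T - τ i) =
        ∑ᶠ n : Fin α → ℤ,
          (∫ τ in Set.univ.pi (fun i =>
              Set.Icc ((((l - n i : ℤ) : ℝ) - 1) * T) (((l - n i : ℤ) : ℝ) * T)), g τ) *
            ∏ i, u (n i) := by
  intro l
  classical
  set S : Finset ℤ := hu.toFinset with hS
  have hprod (τ : Fin α → ℝ) : g τ * ∏ i, uc ((l : ℝ) * T - τ i) =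
      ∑ n ∈ Fintype.piFinset fun _ : Fin α => S,
        (Set.univ.pi fun i => Set.Ioc ((((l - n i : ℤ) : ℝ) - 1) * T)
          (((l - n i : ℤ) : ℝ) * T)).indicator g τ * ∏ i, u (n i) := by
    simp_rw [zeroOrderHold_sub_eq_sum hu huc]
    rw [Finset.prod_univ_sum, Finset.mul_sum]
    refine Finset.sum_congr rfl fun n _ => ?_
    rw [Finset.prod_mul_distrib, prod_indicator_one_eq_indicator_pi, mul_left_comm, mul_comm]
    congr 1
    by_cases h : τ ∈ Set.univ.pi fun i => Set.Ioc ((((l - n i : ℤ) : ℝ) - 1) * T)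
          (((l - n i : ℤ) : ℝ) * T)
    · rw [Set.indicator_of_mem h, Set.indicator_of_mem h, Pi.one_apply, mul_one]
    · rw [Set.indicator_of_notMem h, Set.indicator_of_notMem h, mul_zero]
  have hmeas (n : Fin α → ℤ) : MeasurableSet (Set.univ.pi fun i =>
      Set.Ioc ((((l - n i : ℤ) : ℝ) - 1) * T) (((l - n i : ℤ) : ℝ) * T)) :=
    MeasurableSet.univ_pi fun _ => measurableSet_Ioc
  simp_rw [hprod]
  rw [integral_finsetSum _ fun n _ => (hg.indicator (hmeas n)).mul_const _,
    finsum_eq_sum_of_support_subset (s := Fintype.piFinset fun _ : Fin α => S)]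
  · refine Finset.sum_congr rfl fun n _ => ?_
    rw [integral_mul_const, integral_indicator (hmeas n)]
    congr 1
    refine setIntegral_congr_set ?_
    exact Measure.pi_Ioc_ae_eq_pi_Icc
  · intro n hn
    have hne := right_ne_zero_of_mul (Function.mem_support.mp hn)
    simpa [hS, Fintype.mem_piFinset] using fun i => Finset.prod_ne_zero_iff.mp hne i (Finset.mem_univ i)
end
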